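/- arXiv:1703.04805 — 3 statements merged into one kernel-verified Lean document; each statement's English description precedes it below -/
import Mathlib

section
/- For every real number a and every z in the open unit disc of ℂ, the integral over the unit circle (with normalized arc-length measure σ) of |1 - z·conj(ζ)|^(-2a) dσ(ζ) equals the hypergeometric series ∑_{n=0}^∞ ((a)_n)^2/(n!)^2 · |z|^(2n), i.e. F(a,a;1;|z|²). -/
open MeasureTheory Real Set ComplexConjugate

/-- Pochhammer symbol `(a)_n` for a real number `a`. -/
noncomputable def poch (a : ℝ) (n : ℕ) : ℝ := ∏ i ∈ Finset.range n, (a + i)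

/-- Gauss hypergeometric series `F(a,b;c;x)`. -/
noncomputable def hypF (a b c x : ℝ) : ℝ :=
  ∑' n : ℕ, poch a n * poch b n / (poch c n * n.factorial) * x ^ n

/-- Orthogonality of the exponentials `θ ↦ e^{-inθ}` on `[0, 2π]`. -/
theorem integral_conj_exp_pow_mul_exp_pow (m n : ℕ) :
    ∫ θ in (0:ℝ)..(2 * π), conj (Complex.exp (θ * Complex.I)) ^ m *
        Complex.exp (θ * Complex.I) ^ n = if m = n then (2 * π : ℂ) else 0 := by
  have key (θ : ℝ) : conj (Complex.exp (θ * Complex.I)) ^ m * Complex.exp (θ * Complex.I) ^ n =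
      Complex.exp (((n : ℂ) - m) * Complex.I * θ) := by
    rw [← Complex.exp_conj, ← Complex.exp_nat_mul, ← Complex.exp_nat_mul, ← Complex.exp_add]
    congr 1
    simp only [map_mul, Complex.conj_ofReal, Complex.conj_I]
    ring
  simp_rw [key]
  split_ifs with h
  · simp [h]
  · have hne : ((n : ℂ) - m) * Complex.I ≠ 0 :=
      mul_ne_zero (sub_ne_zero.2 (by exact_mod_cast Ne.symm h)) Complex.I_ne_zero
    have h1 : Complex.exp (((n : ℂ) - m) * Complex.I * ((2 * π : ℝ) : ℂ)) = 1 :=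
      Complex.exp_eq_one_iff.2 ⟨(n : ℤ) - m, by push_cast; ring⟩
    rw [integral_exp_mul_complex hne, h1]
    simp

/-- The double series expansion of the squared modulus of an absolutely convergent series. -/
theorem hasSum_mul_conj_of_summable_norm {ι : Type*} {u : ι → ℂ} (hu : Summable fun n ↦ ‖u n‖) :
    HasSum (fun p : ι × ι ↦ u p.1 * conj (u p.2)) ((‖∑' n, u n‖ ^ 2 : ℝ) : ℂ) := by
  have hv : Summable fun n ↦ ‖conj (u n)‖ := by simpa using hu
  have hsum := (summable_mul_of_summable_norm hu hv).hasSum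
  rw [← tsum_mul_tsum_of_summable_norm hu hv, ← Complex.conj_tsum, Complex.mul_conj'] at hsum
  exact_mod_cast hsum

set_option maxHeartbeats 1000000 in
/-- Parseval's identity for an absolutely convergent one-sided Fourier series. -/
theorem hasSum_integral_norm_sq_tsum_mul_conj_exp_pow {b : ℕ → ℂ} (hb : Summable fun n ↦ ‖b n‖) :
    HasSum (fun n ↦ 2 * π * ‖b n‖ ^ 2)
      (∫ θ in (0:ℝ)..(2 * π), ‖∑' n, b n * conj (Complex.exp (θ * Complex.I)) ^ n‖ ^ 2) := by
  let e (θ : ℝ) : ℂ := Complex.exp (θ * Complex.I)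
  have he (θ : ℝ) : ‖e θ‖ = 1 := Complex.norm_exp_ofReal_mul_I θ
  let F (p : ℕ × ℕ) (θ : ℝ) : ℂ := b p.1 * conj (e θ) ^ p.1 * conj (b p.2 * conj (e θ) ^ p.2)
  have hsum (θ : ℝ) : Summable fun n ↦ ‖b n * conj (e θ) ^ n‖ := by simpa [he] using hb
  have hF (θ : ℝ) :
      HasSum (F · θ) ((‖∑' n, b n * conj (e θ) ^ n‖ ^ 2 : ℝ) : ℂ) :=
    hasSum_mul_conj_of_summable_norm (hsum θ)
  have hbb : Summable fun p : ℕ × ℕ ↦ ‖b p.1‖ * ‖b p.2‖ :=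
    hb.mul_of_nonneg hb (fun _ ↦ norm_nonneg _) fun _ ↦ norm_nonneg _
  have hint := intervalIntegral.hasSum_integral_of_dominated_convergence (μ := volume)
    (a := 0) (b := 2 * π) (F := F) (fun p _ ↦ ‖b p.1‖ * ‖b p.2‖)
    (fun p ↦ by
      have : Continuous (F p) := by fun_prop
      exact this.aestronglyMeasurable)
    (fun p ↦ .of_forall fun θ _ ↦ by simp [F, he])
    (.of_forall fun _ _ ↦ hbb) intervalIntegrable_const (.of_forall fun θ _ ↦ hF θ)
  have hval (p : ℕ × ℕ) : ∫ θ in (0:ℝ)..(2 * π), F p θ =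
      ((if p.1 = p.2 then 2 * π * ‖b p.1‖ ^ 2 else 0 : ℝ) : ℂ) := by
    have h (θ : ℝ) : F p θ = b p.1 * conj (b p.2) * (conj (e θ) ^ p.1 * e θ ^ p.2) := by
      simp only [F, map_mul, map_pow, Complex.conj_conj]
      ring
    simp_rw [h, e]
    rw [intervalIntegral.integral_const_mul, integral_conj_exp_pow_mul_exp_pow]
    split_ifs with hp
    · rw [← hp, Complex.mul_conj']
      push_cast
      ring
    · simp
  simp_rw [hval] at hint
  rw [intervalIntegral.integral_ofReal, Complex.hasSum_ofReal] at hint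
  have hinj : Function.Injective fun n : ℕ ↦ (n, n) := fun _ _ h ↦ (Prod.ext_iff.1 h).1
  rw [← hinj.hasSum_iff] at hint
  · simpa [Function.comp_def, e] using hint
  · rintro ⟨m, n⟩ hmn
    refine if_neg fun h ↦ hmn ⟨m, ?_⟩
    simpa using h

theorem poch_eq_ascPochhammer_eval (a : ℝ) (n : ℕ) : poch a n = (ascPochhammer ℝ n).eval a := by
  induction n with
  | zero => simp [poch]
  | succ n ih => rw [ascPochhammer_succ_eval, ← ih, poch, Finset.prod_range_succ, poch]

theorem poch_one (n : ℕ) : poch 1 n = n.factorial := by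
  rw [poch_eq_ascPochhammer_eval, ascPochhammer_eval_one]

theorem ring_choose_add_sub_one_eq_poch_div (a : ℝ) (n : ℕ) :
    Ring.choose (a + n - 1) n = poch a n / n.factorial := by
  rw [eq_div_iff (by positivity), ← Ring.multichoose_eq, poch_eq_ascPochhammer_eval,
    ← Polynomial.ascPochhammer_smeval_eq_eval, ← Ring.factorial_nsmul_multichoose_eq_ascPochhammer,
    nsmul_eq_mul, mul_comm]

theorem ofScalars_choose_apply (a : ℝ) (w : ℂ) (n : ℕ) :
    (FormalMultilinearSeries.ofScalars ℂ fun n ↦ Ring.choose ((a : ℂ) + n - 1) n) n (fun _ ↦ w) =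
      (poch a n / n.factorial : ℝ) * w ^ n := by
  rw [FormalMultilinearSeries.ofScalars_apply_eq, ← ring_choose_add_sub_one_eq_poch_div,
    Complex.ofReal_choose, smul_eq_mul]
  push_cast
  rfl

theorem hasSum_poch_div_factorial_mul_pow (a : ℝ) {w : ℂ} (hw : ‖w‖ < 1) :
    HasSum (fun n ↦ ((poch a n / n.factorial : ℝ) : ℂ) * w ^ n) (1 / (1 - w) ^ (a : ℂ)) := by
  have h := (Complex.one_div_one_sub_cpow_hasFPowerSeriesOnBall_zero a).hasSum (y := w)
    (by simpa [enorm_eq_nnnorm] using! hw)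
  simpa only [ofScalars_choose_apply, zero_add] using h

theorem summable_norm_poch_div_factorial_mul_pow (a : ℝ) {w : ℂ} (hw : ‖w‖ < 1) :
    Summable fun n ↦ ‖((poch a n / n.factorial : ℝ) : ℂ) * w ^ n‖ := by
  have h := Complex.one_div_one_sub_cpow_hasFPowerSeriesOnBall_zero a
  have hsum := FormalMultilinearSeries.summable_norm_apply _ (x := w)
    (Metric.eball_subset_eball h.r_le (by simpa [enorm_eq_nnnorm] using! hw))
  simpa only [ofScalars_choose_apply] using hsum

/-- Lemma 2.1: the integral over the unit circle, with normalized arc-length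
measure, of `|1 - z⟨z,ζ⟩|^{-2a}` equals `F(a,a;1;|z|²)`. -/
theorem circle_integral_eq_hypF (a : ℝ) (z : ℂ) (hz : ‖z‖ < 1) :
    (1 / (2 * π)) * ∫ θ in (0:ℝ)..(2 * π),
        ‖1 - z * conj (Complex.exp (θ * Complex.I))‖ ^ (-(2 * a)) =
      hypF a a 1 (‖z‖ ^ 2) := by
  have h := hasSum_integral_norm_sq_tsum_mul_conj_exp_pow
    (summable_norm_poch_div_factorial_mul_pow a hz)
  have hint (θ : ℝ) : ‖∑' n, ((poch a n / n.factorial : ℝ) : ℂ) * z ^ n *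
      conj (Complex.exp (θ * Complex.I)) ^ n‖ ^ 2 =
      ‖1 - z * conj (Complex.exp (θ * Complex.I))‖ ^ (-(2 * a)) := by
    have hw : ‖z * conj (Complex.exp (θ * Complex.I))‖ < 1 := by
      simpa [Complex.norm_exp_ofReal_mul_I] using hz
    simp_rw [mul_assoc, ← mul_pow]
    rw [(hasSum_poch_div_factorial_mul_pow a hw).tsum_eq, norm_div, norm_one,
      Complex.norm_cpow_real, one_div, ← Real.rpow_neg (norm_nonneg _), ← Real.rpow_mul_natCast
      (norm_nonneg _)]
    congr 1
    push_cast
    ring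
  simp_rw [hint] at h
  rw [← h.tsum_eq, tsum_mul_left, hypF, ← mul_assoc, one_div_mul_cancel (by positivity), one_mul]
  refine tsum_congr fun n ↦ ?_
  rw [poch_one, norm_mul, norm_pow, Complex.norm_real, mul_pow, Real.norm_eq_abs, sq_abs]
  ring
end

section
/- Let c > 0 and t > -1. Then the supremum over z in the open unit disc 𝔻 of (1-|z|²)^c · ∫_𝔻 (1-|w|²)^t / |1 - z·conj(w)|^{2+t+c} dν(w) equals Γ(t+1)Γ(c)/Γ((2+t+c)/2)², where ν is normalized area measure on 𝔻 (total mass 1). -/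
open MeasureTheory Real Set ComplexConjugate

theorem ascPochhammer_smeval_eq_Gamma_div {a : ℝ} (ha : 0 < a) (n : ℕ) :
    (ascPochhammer ℕ n).smeval a = Gamma (n + a) / Gamma a := by
  have hG := (Gamma_pos_of_pos ha).ne'
  induction n with
  | zero => simp [hG]
  | succ n ih =>
    have h : (0 : ℝ) < n + a := by positivity
    rw [ascPochhammer_succ_right, Polynomial.smeval_mul, ih, Polynomial.smeval_add,
      Polynomial.smeval_X, Polynomial.smeval_natCast]
    rw [show ((n + 1 : ℕ) : ℝ) + a = (n + a) + 1 by push_cast; ring, Gamma_add_one h.ne']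
    simp
    ring

theorem ringChoose_eq_Gamma_div {a : ℝ} (ha : 0 < a) (n : ℕ) :
    Ring.choose (a + n - 1) n = Gamma (n + a) / (Gamma a * n.factorial) := by
  have h := Ring.factorial_nsmul_multichoose_eq_ascPochhammer a n
  rw [ascPochhammer_smeval_eq_Gamma_div ha] at h
  rw [Ring.choose, show a + n - 1 - n + 1 = a by ring]
  rw [nsmul_eq_mul] at h
  have h2 : (n.factorial : ℝ) ≠ 0 := by positivity
  rw [← div_div, ← h]
  field_simp

/-- The `n`-th Taylor coefficient of `(1 - x) ^ (-a)`, for `a > 0`. -/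
noncomputable def negBinomCoeff (a : ℝ) (n : ℕ) : ℝ := Gamma (n + a) / (Gamma a * n.factorial)

theorem negBinomCoeff_pos {a : ℝ} (ha : 0 < a) (n : ℕ) : 0 < negBinomCoeff a n := by
  have := Gamma_pos_of_pos ha
  have : 0 < Gamma (n + a) := Gamma_pos_of_pos (by positivity)
  unfold negBinomCoeff
  positivity

theorem hasSum_negBinomCoeff {a : ℝ} (ha : 0 < a) {x : ℂ} (hx : ‖x‖ < 1) :
    HasSum (fun n => (negBinomCoeff a n : ℂ) * x ^ n) (1 / (1 - x) ^ (a : ℂ)) := by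
  have h := (Complex.one_div_one_sub_cpow_hasFPowerSeriesOnBall_zero (a : ℂ)).hasSum (y := x)
    (by simpa [enorm_eq_nnnorm, ← NNReal.coe_lt_coe] using hx)
  simp only [FormalMultilinearSeries.ofScalars_apply_eq, zero_add, smul_eq_mul] at h
  simp only [negBinomCoeff, ← ringChoose_eq_Gamma_div ha, Complex.ofReal_choose]
  push_cast
  exact h

theorem hasSum_negBinomCoeff_real {a : ℝ} (ha : 0 < a) {x : ℝ} (hx0 : 0 ≤ x) (hx : x < 1) :
    HasSum (fun n => negBinomCoeff a n * x ^ n) (1 / (1 - x) ^ a) := by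
  have h := hasSum_negBinomCoeff ha (x := x) (by simpa [abs_of_nonneg hx0] using hx)
  rw [← Complex.ofReal_one, ← Complex.ofReal_sub, ← Complex.ofReal_cpow (by linarith)] at h
  exact_mod_cast h

theorem hasSum_integral_circle_norm_rpow {a : ℝ} (ha : 0 < a) {x : ℂ} (hx : ‖x‖ < 1) :
    HasSum (fun n => 2 * π * (negBinomCoeff a n ^ 2 * (‖x‖ ^ 2) ^ n))
      (∫ θ in (-π)..π, 1 / ‖1 - x * Complex.exp (-(θ * Complex.I))‖ ^ (2 * a)) := by
  set g : ℝ → ℂ := fun θ => x * Complex.exp (-(θ * Complex.I)) with hg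
  have hgn : ∀ θ, ‖g θ‖ = ‖x‖ := by
    intro θ
    rw [hg]; simp only [norm_mul]
    rw [← neg_mul, ← Complex.ofReal_neg, Complex.norm_exp_ofReal_mul_I, mul_one]
  have hxs := (hasSum_negBinomCoeff_real ha (norm_nonneg x) hx).summable
  let F : ℕ × ℕ → C(ℝ, ℂ) := fun p =>
    ⟨fun θ => ((negBinomCoeff a p.1 : ℂ) * g θ ^ p.1) * conj ((negBinomCoeff a p.2 : ℂ) * g θ ^ p.2),
      by fun_prop⟩
  have hFn : ∀ p θ, ‖F p θ‖ = (negBinomCoeff a p.1 * ‖x‖ ^ p.1) * (negBinomCoeff a p.2 * ‖x‖ ^ p.2) := by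
    intro p θ
    simp [F, hgn, abs_of_pos (negBinomCoeff_pos ha _)]
  have hsF : Summable (fun p : ℕ × ℕ =>
      (negBinomCoeff a p.1 * ‖x‖ ^ p.1) * (negBinomCoeff a p.2 * ‖x‖ ^ p.2)) :=
    hxs.mul_of_nonneg hxs (fun n => by have := negBinomCoeff_pos ha n; positivity)
      (fun n => by have := negBinomCoeff_pos ha n; positivity)
  have hFsum : ∀ θ, HasSum (fun p => F p θ)
      (((1 / ‖1 - g θ‖ ^ (2 * a) : ℝ)) : ℂ) := by
    intro θ
    have h1 := hasSum_negBinomCoeff ha (x := g θ) (by rw [hgn]; exact hx)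
    have h2 := h1.star
    have h4 := h1.mul h2 (by
      refine Summable.of_norm ?_
      refine hsF.congr fun p => ?_
      rw [← hFn p θ]; rfl)
    suffices h5 : (((1 / ‖1 - g θ‖ ^ (2 * a) : ℝ)) : ℂ) =
        1 / (1 - g θ) ^ (a : ℂ) * conj (1 / (1 - g θ) ^ (a : ℂ)) by
      rw [h5]; exact h4
    rw [Complex.mul_conj, Complex.normSq_eq_norm_sq, norm_div, norm_one,
      Complex.norm_cpow_real, div_pow, one_pow, ← Real.rpow_natCast, ← Real.rpow_mul (norm_nonneg _)]
    rw [Nat.cast_ofNat, mul_comm a]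
  have hint := intervalIntegral.hasSum_intervalIntegral_of_summable_norm (a := -π) (b := π) (f := F) (by
    refine Summable.of_nonneg_of_le (fun _ => norm_nonneg _) (fun p => ?_) hsF
    refine (ContinuousMap.norm_le _ (by rw [← hFn p 0]; positivity)).2 fun θ => ?_
    exact (hFn p θ).le)
  simp_rw [(hFsum _).tsum_eq, intervalIntegral.integral_ofReal] at hint
  have hI : ∀ p : ℕ × ℕ, ∫ θ in (-π)..π, F p θ =
      if p.1 = p.2 then ((2 * π * (negBinomCoeff a p.1 ^ 2 * (‖x‖ ^ 2) ^ p.1) : ℝ) : ℂ) else 0 := by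
    rintro ⟨n, m⟩
    have hF : ∀ θ, F (n, m) θ = ((negBinomCoeff a n : ℂ) * x ^ n * conj ((negBinomCoeff a m : ℂ) * x ^ m))
        * Complex.exp ((Complex.I * (m - n)) * θ) := by
      intro θ
      simp only [F, hg, ContinuousMap.coe_mk, map_mul, map_pow, mul_pow, ← Complex.exp_conj,
        ← Complex.exp_nat_mul, map_neg, map_natCast, Complex.conj_I, Complex.conj_ofReal]
      rw [show Complex.I * (m - n) * θ = n * (-(θ * Complex.I)) + m * (-(θ * -Complex.I)) by ring,
        Complex.exp_add]
      ring
    simp only [hF]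
    rw [intervalIntegral.integral_const_mul]
    split_ifs with h
    · subst h
      simp only [sub_self, mul_zero, zero_mul, Complex.exp_zero, intervalIntegral.integral_const]
      rw [Complex.mul_conj, Complex.normSq_eq_norm_sq]
      simp only [norm_mul, norm_pow, Complex.norm_real, norm_eq_abs, mul_pow, sq_abs]
      rw [Complex.real_smul]; push_cast; ring
    · have h' : (m : ℂ) - n ≠ 0 := by
        rw [sub_ne_zero]; exact_mod_cast Ne.symm h
      rw [integral_exp_mul_complex (mul_ne_zero Complex.I_ne_zero h')]
      have : Complex.exp (Complex.I * (m - n) * (π : ℝ)) =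
          Complex.exp (Complex.I * (m - n) * ((-π : ℝ))) := by
        rw [Complex.exp_eq_exp_iff_exists_int]
        exact ⟨m - n, by push_cast; ring⟩
      rw [this, sub_self]; simp
  simp_rw [hI] at hint
  have hinj : Function.Injective (fun n : ℕ => (n, n)) := fun a b h => by simpa using h
  rw [← hinj.hasSum_iff] at hint
  · simp only [Function.comp_def, if_true] at hint
    exact_mod_cast hint
  · rintro ⟨n, m⟩ hnm
    rw [if_neg]
    rintro h
    exact hnm ⟨n, by simp only at h; simp [h]⟩

theorem lintegral_mul_one_sub_sq_rpow {t : ℝ} (ht : -1 < t) (n : ℕ) :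
    ∫⁻ ρ in Ioo (0 : ℝ) 1, ENNReal.ofReal (ρ * (1 - ρ ^ 2) ^ t * (ρ ^ 2) ^ n) =
      ENNReal.ofReal (Gamma (n + 1) * Gamma (t + 1) / Gamma (n + 1 + (t + 1)) / 2) := by
  have hn : (0 : ℝ) < n + 1 := by positivity
  have ht' : 0 < t + 1 := by linarith
  have hb := ProbabilityTheory.beta_pos hn ht'
  have himg : (fun x : ℝ => x ^ 2) '' Ioo 0 1 = Ioo 0 1 := by
    ext y
    constructor
    · rintro ⟨x, ⟨h0, h1⟩, rfl⟩
      exact ⟨by positivity, by simp only; nlinarith⟩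
    · rintro ⟨h0, h1⟩
      exact ⟨√y, ⟨Real.sqrt_pos.2 h0, by rw [Real.sqrt_lt' one_pos]; simpa using h1⟩,
        Real.sq_sqrt h0.le⟩
  have hcov := lintegral_image_eq_lintegral_abs_deriv_mul (s := Ioo (0 : ℝ) 1)
    (f := fun x : ℝ => x ^ 2) (f' := fun x => 2 * x) measurableSet_Ioo
    (fun x _ => by simpa using (hasDerivAt_pow 2 x).hasDerivWithinAt)
    (fun x hx y hy h => by
      simpa [abs_of_pos hx.1, abs_of_pos hy.1] using (sq_eq_sq_iff_abs_eq_abs x y).1 h)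
    (fun x => ProbabilityTheory.betaPDF (n + 1) (t + 1) x)
  have h1 := ProbabilityTheory.lintegral_betaPDF_eq_one hn ht'
  have h2 : ∫⁻ x in Ioo (0 : ℝ) 1, ProbabilityTheory.betaPDF (n + 1) (t + 1) x = 1 := by
    rw [← h1]
    refine setLIntegral_eq_of_support_subset fun x hx => ?_
    by_contra hx'
    refine hx ?_
    rcases le_or_gt x 0 with h | h
    · exact ProbabilityTheory.betaPDF_eq_zero_of_nonpos h
    · exact ProbabilityTheory.betaPDF_eq_zero_of_one_le (not_lt.1 fun h1 => hx' ⟨h, h1⟩)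
  rw [himg, h2] at hcov
  have h3 : ∀ ρ ∈ Ioo (0 : ℝ) 1, ENNReal.ofReal (ρ * (1 - ρ ^ 2) ^ t * (ρ ^ 2) ^ n) =
      ENNReal.ofReal (ProbabilityTheory.beta (n + 1) (t + 1) / 2) *
      (ENNReal.ofReal |2 * ρ| * ProbabilityTheory.betaPDF (n + 1) (t + 1) (ρ ^ 2)) := by
    rintro ρ ⟨h0, h1⟩
    rw [ProbabilityTheory.betaPDF_of_pos_lt_one (by positivity) (by nlinarith),
      ← ENNReal.ofReal_mul (by positivity), ← ENNReal.ofReal_mul (by positivity),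
      abs_of_pos (by positivity)]
    congr 1
    rw [add_sub_cancel_right, add_sub_cancel_right, Real.rpow_natCast]
    field_simp
  rw [setLIntegral_congr_fun measurableSet_Ioo h3, lintegral_const_mul', ← hcov, mul_one]
  · rfl
  · simp

theorem lintegral_disc_eq_tsum {a t : ℝ} (ha : 0 < a) (ht : -1 < t) {z : ℂ} (hz : ‖z‖ < 1) :
    ∫⁻ w in Metric.ball (0 : ℂ) 1,
        ENNReal.ofReal ((1 - ‖w‖ ^ 2) ^ t / ‖1 - z * conj w‖ ^ (2 * a)) =
      ∑' n : ℕ, ENNReal.ofReal (π * (negBinomCoeff a n ^ 2 * (‖z‖ ^ 2) ^ n *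
        (Gamma (n + 1) * Gamma (t + 1) / Gamma (n + 1 + (t + 1))))) := by
  set f : ℂ → ENNReal := fun w =>
    ENNReal.ofReal ((1 - ‖w‖ ^ 2) ^ t / ‖1 - z * conj w‖ ^ (2 * a)) with hf
  have hfm : Measurable f := by
    simp only [hf]; fun_prop
  rw [← lintegral_indicator Metric.isOpen_ball.measurableSet,
    ← Complex.lintegral_comp_polarCoord_symm, polarCoord_target, Measure.volume_eq_prod,
    setLIntegral_prod]
  swap
  · have : Measurable fun p : ℝ × ℝ => Complex.polarCoord.symm p := by
      simp only [Complex.polarCoord_symm_apply]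
      fun_prop
    refine Measurable.aemeasurable ?_
    refine (ENNReal.measurable_ofReal.comp measurable_fst).mul ?_
    exact (hfm.indicator Metric.isOpen_ball.measurableSet).comp this
  have hinner : ∀ ρ ∈ Ioi (0 : ℝ), (∫⁻ θ in Ioo (-π) π, ENNReal.ofReal ρ •
      (Metric.ball (0 : ℂ) 1).indicator f (Complex.polarCoord.symm (ρ, θ))) =
      (Ioo (0 : ℝ) 1).indicator (fun ρ => ∑' n : ℕ, ENNReal.ofReal (2 * π * (negBinomCoeff a n ^ 2 * (‖z‖ ^ 2) ^ n)) *
        ENNReal.ofReal (ρ * (1 - ρ ^ 2) ^ t * (ρ ^ 2) ^ n)) ρ := by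
    intro ρ hρ
    have hρ0 : 0 < ρ := hρ
    by_cases h1 : ρ < 1
    · have hx : ‖z * ρ‖ < 1 := by
        rw [norm_mul, Complex.norm_real, norm_eq_abs, abs_of_pos hρ0]
        nlinarith [norm_nonneg z]
      have hs := hasSum_integral_circle_norm_rpow ha hx
      have hρ1 : 0 ≤ ρ * (1 - ρ ^ 2) ^ t :=
        mul_nonneg hρ0.le (Real.rpow_nonneg (by nlinarith) _)
      have hpt : ∀ θ : ℝ, ENNReal.ofReal ρ •
          (Metric.ball (0 : ℂ) 1).indicator f (Complex.polarCoord.symm (ρ, θ)) =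
          ENNReal.ofReal (ρ * (1 - ρ ^ 2) ^ t) * ENNReal.ofReal
            (1 / ‖1 - z * ρ * Complex.exp (-(θ * Complex.I))‖ ^ (2 * a)) := by
        intro θ
        have hn : ‖Complex.polarCoord.symm (ρ, θ)‖ = ρ := by
          rw [Complex.norm_polarCoord_symm, abs_of_pos hρ0]
        have hconj : conj (Complex.polarCoord.symm (ρ, θ)) = ρ * Complex.exp (-(θ * Complex.I)) := by
          rw [Complex.polarCoord_symm_apply, Complex.ofReal_cos, Complex.ofReal_sin,
            ← Complex.exp_mul_I, map_mul, ← Complex.exp_conj]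
          simp
        rw [indicator_of_mem (by rw [mem_ball_zero_iff, hn]; exact h1), hf]
        simp only [hn, hconj]
        rw [smul_eq_mul, ← ENNReal.ofReal_mul hρ0.le, ← ENNReal.ofReal_mul hρ1, ← mul_assoc z]
        congr 1; ring
      rw [indicator_of_mem (show ρ ∈ Ioo (0 : ℝ) 1 from ⟨hρ0, h1⟩)]
      simp_rw [hpt]
      rw [lintegral_const_mul' _ _ ENNReal.ofReal_ne_top, restrict_Ioo_eq_restrict_Ioc,
        ← ofReal_integral_eq_lintegral_ofReal, ← intervalIntegral.integral_of_le (by linarith [pi_pos]),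
        ← hs.tsum_eq, ENNReal.ofReal_tsum_of_nonneg _ hs.summable, ← ENNReal.tsum_mul_left]
      · refine tsum_congr fun n => ?_
        rw [← ENNReal.ofReal_mul hρ1, ← ENNReal.ofReal_mul (by positivity), norm_mul,
          Complex.norm_real, norm_eq_abs, abs_of_pos hρ0]
        congr 1; ring
      · intro n; positivity
      · rw [← IntegrableOn, ← intervalIntegrable_iff_integrableOn_Ioc_of_le (by linarith [pi_pos])]
        refine Continuous.intervalIntegrable ?_ _ _
        have hne : ∀ θ : ℝ, ‖1 - z * ρ * Complex.exp (-(θ * Complex.I))‖ ≠ 0 := by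
          intro θ h0
          rw [norm_eq_zero, sub_eq_zero] at h0
          have h3 : ‖z * ρ * Complex.exp (-(θ * Complex.I))‖ = ‖z * ρ‖ := by
            rw [norm_mul _ (Complex.exp _), ← neg_mul, ← Complex.ofReal_neg,
              Complex.norm_exp_ofReal_mul_I, mul_one]
          rw [← h0, norm_one] at h3
          linarith
        refine continuous_const.div (Continuous.rpow_const (by fun_prop) fun θ => .inl (hne θ)) ?_
        intro θ
        exact (Real.rpow_pos_of_pos (lt_of_le_of_ne (norm_nonneg _) (hne θ).symm) _).ne'
      · exact Filter.Eventually.of_forall fun θ => by simp only [Pi.zero_apply]; positivity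
    · rw [indicator_of_notMem (by simp [h1])]
      have hpt : ∀ θ : ℝ, (Metric.ball (0 : ℂ) 1).indicator f
          (Complex.polarCoord.symm (ρ, θ)) = 0 := fun θ => indicator_of_notMem (by
        rw [mem_ball_zero_iff, Complex.norm_polarCoord_symm, abs_of_pos hρ0]; exact h1) _
      simp only [hpt, smul_zero, lintegral_zero]
  rw [setLIntegral_congr_fun measurableSet_Ioi hinner, setLIntegral_indicator measurableSet_Ioo,
    inter_eq_left.2 (fun x hx => hx.1), lintegral_tsum (fun n => by fun_prop)]
  refine tsum_congr fun n => ?_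
  rw [lintegral_const_mul' _ _ ENNReal.ofReal_ne_top, lintegral_mul_one_sub_sq_rpow ht,
    ← ENNReal.ofReal_mul (by positivity)]
  congr 1; ring

theorem Gamma_midpoint_sq_le {x y : ℝ} (hx : 0 < x) (hy : 0 < y) :
    Gamma ((x + y) / 2) ^ 2 ≤ Gamma x * Gamma y := by
  have h := Gamma_mul_add_mul_le_rpow_Gamma_mul_rpow_Gamma hx hy (a := 1 / 2) (b := 1 / 2)
    (by norm_num) (by norm_num) (by norm_num)
  rw [← Real.sqrt_eq_rpow, ← Real.sqrt_eq_rpow] at h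
  have h0 : 0 ≤ Gamma ((x + y) / 2) := (Gamma_pos_of_pos (by linarith)).le
  calc Gamma ((x + y) / 2) ^ 2 = Gamma (1 / 2 * x + 1 / 2 * y) ^ 2 := by congr 2; ring
    _ ≤ (√(Gamma x) * √(Gamma y)) ^ 2 := by
        gcongr
    _ = Gamma x * Gamma y := by
        rw [mul_pow, Real.sq_sqrt (Gamma_pos_of_pos hx).le, Real.sq_sqrt (Gamma_pos_of_pos hy).le]

theorem prod_range_add_eq_Gamma_div {s : ℝ} (hs : 0 < s) (n : ℕ) :
    ∏ j ∈ Finset.range n, (s + j) = Gamma (n + s) / Gamma s := by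
  have hG := (Gamma_pos_of_pos hs).ne'
  induction n with
  | zero => simp [hG]
  | succ n ih =>
    have h : (0 : ℝ) < n + s := by positivity
    rw [Finset.prod_range_succ, ih, show ((n + 1 : ℕ) : ℝ) + s = (n + s) + 1 by push_cast; ring,
      Gamma_add_one h.ne']
    ring

open Filter Topology in
theorem tendsto_Gamma_midpoint_sq_div {x y : ℝ} (hx : 0 < x) (hy : 0 < y) :
    Tendsto (fun n : ℕ => Gamma (n + (x + y) / 2) ^ 2 / (Gamma (n + x) * Gamma (n + y)))
      atTop (𝓝 1) := by
  have hm : 0 < (x + y) / 2 := by linarith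
  rw [← tendsto_add_atTop_iff_nat 1]
  have hGx := (Gamma_pos_of_pos hx).ne'
  have hGy := (Gamma_pos_of_pos hy).ne'
  have hGm := (Gamma_pos_of_pos hm).ne'
  have h := (((GammaSeq_tendsto_Gamma x).div_const (Gamma x)).mul
    ((GammaSeq_tendsto_Gamma y).div_const (Gamma y))).div
    (((GammaSeq_tendsto_Gamma ((x + y) / 2)).div_const (Gamma ((x + y) / 2))).pow 2) (by simp [hGm])
  rw [div_self hGx, div_self hGy, div_self hGm] at h
  norm_num at h
  refine h.congr' ?_
  filter_upwards [eventually_gt_atTop 0] with n hn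
  have hn' : (0 : ℝ) < n := by exact_mod_cast hn
  have hpow : (n : ℝ) ^ x * (n : ℝ) ^ y = ((n : ℝ) ^ ((x + y) / 2)) ^ 2 := by
    rw [← Real.rpow_add hn', ← Real.rpow_natCast, ← Real.rpow_mul hn'.le]
    congr 1; push_cast; ring
  have e : ∀ s : ℝ, 0 < s → GammaSeq s n / Gamma s = n ^ s * n.factorial / Gamma ((n + 1 : ℕ) + s) := by
    intro s hs
    have h1 := (Gamma_pos_of_pos hs).ne'
    have h2 := (Gamma_pos_of_pos (show 0 < ((n + 1 : ℕ) : ℝ) + s by positivity)).ne'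
    rw [GammaSeq, prod_range_add_eq_Gamma_div hs]
    field_simp
  rw [Pi.div_apply, e x hx, e y hy, e _ hm]
  have h1 := (Gamma_pos_of_pos (show 0 < ((n + 1 : ℕ) : ℝ) + x by positivity)).ne'
  have h2 := (Gamma_pos_of_pos (show 0 < ((n + 1 : ℕ) : ℝ) + y by positivity)).ne'
  have h3 := (Gamma_pos_of_pos (show 0 < ((n + 1 : ℕ) : ℝ) + (x + y) / 2 by positivity)).ne'
  have h4 : (n.factorial : ℝ) ≠ 0 := by positivity
  have h5 : (n : ℝ) ^ ((x + y) / 2) ≠ 0 := by positivity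
  rw [div_mul_div_comm, mul_mul_mul_comm, hpow]
  field_simp

theorem Gamma_add_midpoint_sq_div_nonneg {x y : ℝ} (hx : 0 < x) (hy : 0 < y) (n : ℕ) :
    0 ≤ Gamma (n + (x + y) / 2) ^ 2 / (Gamma (n + x) * Gamma (n + y)) := by
  have h1 := Gamma_pos_of_pos (show (0 : ℝ) < n + x by positivity)
  have h2 := Gamma_pos_of_pos (show (0 : ℝ) < n + y by positivity)
  positivity

theorem Gamma_add_midpoint_sq_div_le_one {x y : ℝ} (hx : 0 < x) (hy : 0 < y) (n : ℕ) :
    Gamma (n + (x + y) / 2) ^ 2 / (Gamma (n + x) * Gamma (n + y)) ≤ 1 := by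
  have hx' : (0 : ℝ) < n + x := by positivity
  have hy' : (0 : ℝ) < n + y := by positivity
  have h1 := Gamma_pos_of_pos hx'
  have h2 := Gamma_pos_of_pos hy'
  rw [div_le_one (by positivity), show n + (x + y) / 2 = ((n + x) + (n + y)) / 2 by ring]
  exact Gamma_midpoint_sq_le hx' hy'

/-- The series expansion of the weighted disc integral, compared termwise with `(1 - ‖z‖ ^ 2) ^ (-c)`. -/
theorem hasSum_integral_disc {c t : ℝ} (hc : 0 < c) (ht : -1 < t) {z : ℂ} (hz : ‖z‖ < 1) :
    HasSum (fun n : ℕ => Gamma (t + 1) * Gamma c / Gamma ((2 + t + c) / 2) ^ 2 *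
        (Gamma (n + (c + (t + 2)) / 2) ^ 2 / (Gamma (n + c) * Gamma (n + (t + 2))) *
          (negBinomCoeff c n * (‖z‖ ^ 2) ^ n)))
      ((∫ w in Metric.ball (0 : ℂ) 1,
        (1 - ‖w‖ ^ 2) ^ t / ‖1 - z * conj w‖ ^ (2 + t + c)) / π) := by
  have ha : 0 < (2 + t + c) / 2 := by linarith
  have ht2 : 0 < t + 2 := by linarith
  have hr1 : ‖z‖ ^ 2 < 1 := by nlinarith [norm_nonneg z]
  have hGc := Gamma_pos_of_pos hc
  have hGa := Gamma_pos_of_pos ha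
  have hGt := Gamma_pos_of_pos (show 0 < t + 1 by linarith)
  have hterm := fun n : ℕ => And.intro (Gamma_add_midpoint_sq_div_nonneg hc ht2 n)
    (Gamma_add_midpoint_sq_div_le_one hc ht2 n)
  have hsummable : Summable (fun n : ℕ => Gamma (t + 1) * Gamma c / Gamma ((2 + t + c) / 2) ^ 2 *
        (Gamma (n + (c + (t + 2)) / 2) ^ 2 / (Gamma (n + c) * Gamma (n + (t + 2))) *
          (negBinomCoeff c n * (‖z‖ ^ 2) ^ n))) := by
    refine Summable.mul_left _ (Summable.of_nonneg_of_le (fun n => ?_) (fun n => ?_)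
      (hasSum_negBinomCoeff_real hc (sq_nonneg ‖z‖) hr1).summable)
    · have := negBinomCoeff_pos hc n
      exact mul_nonneg (hterm n).1 (by positivity)
    · have := negBinomCoeff_pos hc n
      exact mul_le_of_le_one_left (by positivity) (hterm n).2
  have hnonneg : ∀ n : ℕ, 0 ≤ π * (Gamma (t + 1) * Gamma c / Gamma ((2 + t + c) / 2) ^ 2 *
        (Gamma (n + (c + (t + 2)) / 2) ^ 2 / (Gamma (n + c) * Gamma (n + (t + 2))) *
          (negBinomCoeff c n * (‖z‖ ^ 2) ^ n))) := fun n => by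
    have := negBinomCoeff_pos hc n
    have := (hterm n).1
    positivity
  have key := lintegral_disc_eq_tsum ha ht hz
  rw [mul_div_cancel₀ _ (two_ne_zero' ℝ)] at key
  have hcoef : ∀ n : ℕ, π * (negBinomCoeff ((2 + t + c) / 2) n ^ 2 * (‖z‖ ^ 2) ^ n *
        (Gamma (n + 1) * Gamma (t + 1) / Gamma (n + 1 + (t + 1)))) =
      π * (Gamma (t + 1) * Gamma c / Gamma ((2 + t + c) / 2) ^ 2 *
        (Gamma (n + (c + (t + 2)) / 2) ^ 2 / (Gamma (n + c) * Gamma (n + (t + 2))) *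
          (negBinomCoeff c n * (‖z‖ ^ 2) ^ n))) := by
    intro n
    have h1 := Gamma_pos_of_pos (show (0 : ℝ) < n + c by positivity)
    have h2 := Gamma_pos_of_pos (show (0 : ℝ) < n + (t + 2) by positivity)
    rw [negBinomCoeff, negBinomCoeff, Gamma_nat_eq_factorial,
      show (n : ℝ) + 1 + (t + 1) = n + (t + 2) by ring,
      show (c + (t + 2)) / 2 = (2 + t + c) / 2 by ring]
    field_simp
  simp_rw [hcoef] at key
  rw [← ENNReal.ofReal_tsum_of_nonneg hnonneg (hsummable.mul_left π)] at key
  rw [integral_eq_lintegral_of_nonneg_ae, key, ENNReal.toReal_ofReal (tsum_nonneg hnonneg),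
    tsum_mul_left, mul_div_cancel_left₀ _ pi_ne_zero]
  · exact hsummable.hasSum
  · refine ae_restrict_of_forall_mem Metric.isOpen_ball.measurableSet fun w hw => ?_
    have hw1 : ‖w‖ < 1 := mem_ball_zero_iff.1 hw
    have : 0 ≤ 1 - ‖w‖ ^ 2 := by nlinarith [norm_nonneg w]
    simp only [Pi.zero_apply]
    positivity
  · exact Measurable.aestronglyMeasurable (by fun_prop)

open Filter Topology in
/-- An Abelian lemma: if `0 ≤ u n ≤ 1` and `u n → 1`, then damping the Taylor series of `(1 - x) ^ (-c)`
termwise by `u` gives a function whose ratio to `(1 - x) ^ (-c)` on `[0, 1)` has supremum `1`. -/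
theorem isLUB_one_sub_rpow_mul_tsum {c : ℝ} (hc : 0 < c) {u : ℕ → ℝ}
    (hu0 : ∀ n, 0 ≤ u n) (hu1 : ∀ n, u n ≤ 1) (hu : Tendsto u atTop (𝓝 1)) :
    IsLUB ((fun x : ℝ => (1 - x) ^ c * ∑' n, u n * (negBinomCoeff c n * x ^ n)) '' Ico 0 1) 1 := by
  have hb := fun n => negBinomCoeff_pos hc n
  have hsum : ∀ x ∈ Ico (0 : ℝ) 1, Summable fun n => u n * (negBinomCoeff c n * x ^ n) := by
    intro x hx
    have hx0 := hx.1
    exact Summable.of_nonneg_of_le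
      (fun n => mul_nonneg (hu0 n) (mul_nonneg (hb n).le (by positivity)))
      (fun n => mul_le_of_le_one_left (mul_nonneg (hb n).le (by positivity)) (hu1 n))
      (hasSum_negBinomCoeff_real hc hx.1 hx.2).summable
  constructor
  · rintro _ ⟨x, hx, rfl⟩
    have hx0 := hx.1
    have hB := hasSum_negBinomCoeff_real hc hx.1 hx.2
    have hp : 0 < (1 - x) ^ c := Real.rpow_pos_of_pos (by linarith [hx.2]) _
    have hle : ∑' n, u n * (negBinomCoeff c n * x ^ n) ≤ 1 / (1 - x) ^ c := by
      rw [← hB.tsum_eq]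
      exact (hsum x hx).tsum_le_tsum
        (fun n => mul_le_of_le_one_left (mul_nonneg (hb n).le (by positivity)) (hu1 n)) hB.summable
    calc (1 - x) ^ c * ∑' n, u n * (negBinomCoeff c n * x ^ n)
        ≤ (1 - x) ^ c * (1 / (1 - x) ^ c) := by gcongr
      _ = 1 := by field_simp
  · intro M hM
    refine le_of_forall_pos_le_add fun ε hε => ?_
    obtain ⟨N, hN⟩ := eventually_atTop.1 (hu.eventually (lt_mem_nhds (show 1 - ε < 1 by linarith)))
    set C := ∑ n ∈ Finset.range N, negBinomCoeff c n
    have hlow : ∀ x ∈ Ico (0 : ℝ) 1, (1 - ε) - C * (1 - x) ^ c ≤ M := by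
      intro x hx
      have hx0 := hx.1
      have hB := hasSum_negBinomCoeff_real hc hx.1 hx.2
      have hp : 0 < (1 - x) ^ c := Real.rpow_pos_of_pos (by linarith [hx.2]) _
      have hfin : HasSum (fun n => if n ∈ Finset.range N then negBinomCoeff c n else 0) C := by
        have := hasSum_sum_of_ne_finset_zero (s := Finset.range N) (L := .unconditional ℕ)
          (f := fun n => if n ∈ Finset.range N then negBinomCoeff c n else 0)
          (fun n hn => if_neg hn)
        rwa [Finset.sum_congr rfl fun n hn => if_pos hn] at this
      have hle : (1 - ε) * (1 / (1 - x) ^ c) - C ≤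
          ∑' n, u n * (negBinomCoeff c n * x ^ n) := by
        refine hasSum_le (fun n => ?_) ((hB.mul_left (1 - ε)).sub hfin) (hsum x hx).hasSum
        have hbn : 0 ≤ negBinomCoeff c n * x ^ n := mul_nonneg (hb n).le (by positivity)
        split_ifs with h
        · have h1 : negBinomCoeff c n * x ^ n ≤ negBinomCoeff c n :=
            mul_le_of_le_one_right (hb n).le (pow_le_one₀ hx.1 hx.2.le)
          nlinarith [mul_nonneg (hu0 n) hbn, mul_nonneg hε.le hbn]
        · rw [sub_zero]
          exact mul_le_mul_of_nonneg_right (hN n (by simpa using h)).le hbn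
      refine le_trans ?_ (hM ⟨x, hx, rfl⟩)
      calc (1 - ε) - C * (1 - x) ^ c = (1 - x) ^ c * ((1 - ε) * (1 / (1 - x) ^ c) - C) := by
            field_simp
        _ ≤ _ := by simp only; gcongr
    have hlim : Tendsto (fun x : ℝ => (1 - ε) - C * (1 - x) ^ c) (𝓝[<] 1) (𝓝 (1 - ε)) := by
      have : ContinuousAt (fun x : ℝ => (1 - ε) - C * (1 - x) ^ c) 1 :=
        continuousAt_const.sub (continuousAt_const.mul
          ((continuousAt_const.sub continuousAt_id).rpow_const (.inr hc.le)))
      have h := this.tendsto.mono_left (nhdsWithin_le_nhds (s := Iio 1))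
      simpa [Real.zero_rpow hc.ne'] using h
    have := le_of_tendsto hlim (by
      filter_upwards [Ico_mem_nhdsLT (show (0 : ℝ) < 1 by norm_num)] with x hx using hlow x hx)
    linarith

/-- Lemma 2.2 (Liu): for `c > 0` and `t > -1`, the supremum over `z` in the unit
disc of `(1-|z|²)^c ∫_𝔻 (1-|w|²)^t/|1-z·conj w|^{2+t+c} dν(w)` (with `ν` the
normalized area measure on the disc) equals `Γ(t+1)Γ(c)/Γ((2+t+c)/2)²`. -/
theorem sup_disc_integral (c t : ℝ) (hc : 0 < c) (ht : -1 < t) :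
    sSup {x : ℝ | ∃ z : ℂ, ‖z‖ < 1 ∧
        x = (1 - ‖z‖ ^ 2) ^ c *
          ((∫ w in Metric.ball (0:ℂ) 1,
              (1 - ‖w‖ ^ 2) ^ t / ‖1 - z * conj w‖ ^ (2 + t + c)) / π)} =
      Real.Gamma (t + 1) * Real.Gamma c / Real.Gamma ((2 + t + c) / 2) ^ 2 := by
  have ht2 : 0 < t + 2 := by linarith
  have hK : 0 < Gamma (t + 1) * Gamma c / Gamma ((2 + t + c) / 2) ^ 2 := by
    have h1 := Gamma_pos_of_pos hc
    have h2 := Gamma_pos_of_pos (show 0 < (2 + t + c) / 2 by linarith)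
    have h3 := Gamma_pos_of_pos (show 0 < t + 1 by linarith)
    positivity
  have hL := isLUB_one_sub_rpow_mul_tsum hc (Gamma_add_midpoint_sq_div_nonneg hc ht2)
    (Gamma_add_midpoint_sq_div_le_one hc ht2) (tendsto_Gamma_midpoint_sq_div hc ht2)
  have hval : ∀ z : ℂ, ‖z‖ < 1 → (1 - ‖z‖ ^ 2) ^ c *
      ((∫ w in Metric.ball (0:ℂ) 1,
        (1 - ‖w‖ ^ 2) ^ t / ‖1 - z * conj w‖ ^ (2 + t + c)) / π) =
      Gamma (t + 1) * Gamma c / Gamma ((2 + t + c) / 2) ^ 2 * ((1 - ‖z‖ ^ 2) ^ c *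
        ∑' n : ℕ, Gamma (n + (c + (t + 2)) / 2) ^ 2 / (Gamma (n + c) * Gamma (n + (t + 2))) *
          (negBinomCoeff c n * (‖z‖ ^ 2) ^ n)) := by
    intro z hz
    rw [← (hasSum_integral_disc hc ht hz).tsum_eq, tsum_mul_left]
    ring
  refine IsLUB.csSup_eq ⟨?_, ?_⟩ ⟨_, 0, by simp, rfl⟩
  · rintro _ ⟨z, hz, rfl⟩
    rw [hval z hz]
    refine mul_le_of_le_one_right hK.le (hL.1 ⟨‖z‖ ^ 2, ⟨sq_nonneg _, ?_⟩, rfl⟩)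
    nlinarith [norm_nonneg z]
  · intro M hM
    have h : 1 ≤ M / (Gamma (t + 1) * Gamma c / Gamma ((2 + t + c) / 2) ^ 2) := by
      refine hL.2 ?_
      rintro _ ⟨x, ⟨hx0, hx1⟩, rfl⟩
      have hn : ‖((√x : ℝ) : ℂ)‖ = √x := by simp [abs_of_nonneg (Real.sqrt_nonneg x)]
      have hz : ‖((√x : ℝ) : ℂ)‖ < 1 := by
        rw [hn, Real.sqrt_lt' one_pos]; simpa using hx1
      rw [le_div_iff₀' hK]
      have h1 := hM ⟨_, hz, rfl⟩
      rwa [hval _ hz, hn, Real.sq_sqrt hx0] at h1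
    rwa [le_div_iff₀ hK, one_mul] at h
end

section
/- For 4/3 < p < 4 and (ξ₁,ξ₂) ∈ ℋ, let f_{(ξ₁,ξ₂)}(z₁,z₂) = (1-ξ₂·conj(z₂))^{1-2/p}/(z₂(1-z₂·conj(ξ₂))) · (1-(ξ₁/ξ₂)(conj(z₁)/conj(z₂)))^{1-2/p}/(1-(z₁/z₂)(conj(ξ₁)/conj(ξ₂))). Then ‖f_{(ξ₁,ξ₂)}‖_p^p = ∫_{𝔻*} |z₂|^{2-p}/|1-z₂·conj(ξ₂)|² · [∫_𝔻 |1-(conj(ξ₁)/conj(ξ₂))u|^{-2} dν(u)] dν(z₂), and consequently ‖f_{(ξ₁,ξ₂)}‖_p^p is comparable to log(1/(1-|ξ₂|²)) · log(1/(1-|ξ₁/ξ₂|²)) as |ξ₂| → 1⁻ and |ξ₁/ξ₂| → 1⁻. -/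
open MeasureTheory Real Set ComplexConjugate

/-- The Hartogs triangle. -/
def Hartogs : Set (ℂ × ℂ) := {z | ‖z.1‖ < ‖z.2‖ ∧ ‖z.2‖ < 1}

/-- The measure `μ = dV/π²` on the Hartogs triangle. -/
noncomputable def muH : Measure (ℂ × ℂ) :=
  (ENNReal.ofReal (π ^ 2))⁻¹ • (volume.restrict Hartogs)

/-- The test function `f_{(ξ₁,ξ₂)}`. -/
noncomputable def testF (p : ℝ) (ξ z : ℂ × ℂ) : ℂ :=
  (1 - ξ.2 * conj z.2) ^ (((1 - 2 / p : ℝ) : ℂ)) / (z.2 * (1 - z.2 * conj ξ.2)) *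
    ((1 - ξ.1 / ξ.2 * (conj z.1 / conj z.2)) ^ (((1 - 2 / p : ℝ) : ℂ)) /
      (1 - z.1 / z.2 * (conj ξ.1 / conj ξ.2)))

theorem lintegral_comp_complex_mul_left (h : ℂ → ENNReal) (hh : Measurable h) {w : ℂ}
    (hw : w ≠ 0) :
    ∫⁻ z, h (w * z) = ENNReal.ofReal (‖w‖ ^ 2)⁻¹ * ∫⁻ u, h u := by
  have hdet : LinearMap.det (Algebra.lmul ℝ ℂ w) = ‖w‖ ^ 2 := by
    rw [← Algebra.norm_apply, Algebra.norm_complex_apply, Complex.normSq_eq_norm_sq]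
  have hmap := Measure.map_linearMap_addHaar_eq_smul_addHaar (volume : Measure ℂ)
    (f := Algebra.lmul ℝ ℂ w) (by rw [hdet]; positivity)
  rw [hdet, abs_of_nonneg (by positivity)] at hmap
  have hcoe : (⇑(Algebra.lmul ℝ ℂ w) : ℂ → ℂ) = fun z => w * z := by ext; simp
  rw [hcoe] at hmap
  rw [← lintegral_map (μ := volume) hh (measurable_const_mul w), hmap, lintegral_smul_measure,
    smul_eq_mul]

theorem measurableSet_Hartogs : MeasurableSet Hartogs :=
  (measurableSet_lt (f := fun z : ℂ × ℂ => ‖z.1‖) (g := fun z => ‖z.2‖)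
    (by fun_prop) (by fun_prop)).inter
    (measurableSet_lt (f := fun z : ℂ × ℂ => ‖z.2‖) (g := fun _ => 1) (by fun_prop) (by fun_prop))

theorem lintegral_Hartogs_mul (g h : ℂ → ENNReal) (hg : Measurable g) (hh : Measurable h) :
    ∫⁻ z in Hartogs, g z.2 * h (z.1 / z.2) =
      (∫⁻ w in Metric.ball (0 : ℂ) 1 \ {0}, ENNReal.ofReal (‖w‖ ^ 2) * g w) *
        ∫⁻ u in Metric.ball (0 : ℂ) 1, h u := by
  have hball : MeasurableSet (Metric.ball (0 : ℂ) 1) := Metric.isOpen_ball.measurableSet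
  have hpball : MeasurableSet (Metric.ball (0 : ℂ) 1 \ {0}) :=
    hball.diff (measurableSet_singleton 0)
  rw [← lintegral_indicator measurableSet_Hartogs, Measure.volume_eq_prod, lintegral_prod_symm']
  swap
  · exact (by fun_prop : Measurable fun z : ℂ × ℂ => g z.2 * h (z.1 / z.2)).indicator
      measurableSet_Hartogs
  rw [← lintegral_mul_const _ (by fun_prop), ← lintegral_indicator hpball]
  refine lintegral_congr fun w => ?_
  by_cases hw : w ∈ Metric.ball (0 : ℂ) 1 \ {0}
  · have hw0 : w ≠ 0 := hw.2
    have hw1 : ‖w‖ < 1 := by simpa using hw.1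
    rw [indicator_of_mem hw]
    have key : ∀ z : ℂ, Hartogs.indicator (fun z : ℂ × ℂ => g z.2 * h (z.1 / z.2)) (z, w) =
        g w * (Metric.ball (0 : ℂ) 1).indicator h (w⁻¹ * z) := by
      intro z
      have hiff : (z, w) ∈ Hartogs ↔ w⁻¹ * z ∈ Metric.ball (0 : ℂ) 1 := by
        have : 0 < ‖w‖ := norm_pos_iff.2 hw0
        simp [Hartogs, hw1, inv_mul_lt_iff₀ this]
      by_cases hz : (z, w) ∈ Hartogs
      · rw [indicator_of_mem hz, indicator_of_mem (hiff.1 hz), div_eq_inv_mul]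
      · rw [indicator_of_notMem hz, indicator_of_notMem (fun h' => hz (hiff.2 h')), mul_zero]
    simp_rw [key]
    have hmi : Measurable ((Metric.ball (0 : ℂ) 1).indicator h) := hh.indicator hball
    rw [lintegral_const_mul _ (by fun_prop),
      lintegral_comp_complex_mul_left _ hmi (inv_ne_zero hw0), lintegral_indicator hball]
    simp only [norm_inv, inv_pow, inv_inv]
    ring
  · rw [indicator_of_notMem hw]
    refine (lintegral_congr fun z => ?_).trans lintegral_zero
    refine indicator_of_notMem (fun hz => hw ⟨by simpa using hz.2, ?_⟩) _
    rintro rfl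
    exact absurd hz.1 (by simp)

theorem integral_muH (p : ℝ) (ξ : ℂ × ℂ) :
    ∫ z, ‖testF p ξ z‖ ^ p ∂muH = (∫ z in Hartogs, ‖testF p ξ z‖ ^ p) / π ^ 2 := by
  rw [muH, integral_smul_measure, ENNReal.toReal_inv, ENNReal.toReal_ofReal (by positivity),
    smul_eq_mul, inv_mul_eq_div]

theorem one_sub_mul_conj_ne_zero {z a : ℂ} (hz : ‖z‖ ≤ 1) (ha : ‖a‖ < 1) :
    1 - z * conj a ≠ 0 := by
  intro h
  have h1 : ‖z * conj a‖ = 1 := by rw [← sub_eq_zero.1 h, norm_one]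
  rw [norm_mul, RCLike.norm_conj] at h1
  nlinarith [norm_nonneg z, norm_nonneg a]

theorem norm_one_sub_mul_conj_comm (z a : ℂ) : ‖1 - a * conj z‖ = ‖1 - z * conj a‖ := by
  rw [← RCLike.norm_conj (1 - z * conj a)]
  simp [mul_comm]

theorem norm_cpow_div_rpow {p : ℝ} (hp : 0 < p) {x y : ℂ} (hxy : ‖x‖ = ‖y‖) (hy : y ≠ 0) :
    ‖x ^ (((1 - 2 / p : ℝ) : ℂ)) / y‖ ^ p = 1 / ‖y‖ ^ 2 := by
  have hy' : 0 < ‖y‖ := norm_pos_iff.2 hy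
  rw [norm_div, Complex.norm_cpow_real, hxy, ← Real.rpow_sub_one hy'.ne', ← Real.rpow_mul hy'.le,
    show (1 - 2 / p - 1) * p = -2 by field_simp; ring, Real.rpow_neg hy'.le, one_div]
  norm_num

theorem norm_div_lt_one_of_mem_Hartogs {z : ℂ × ℂ} (hz : z ∈ Hartogs) : ‖z.1 / z.2‖ < 1 := by
  have : 0 < ‖z.2‖ := (norm_nonneg _).trans_lt hz.1
  rw [norm_div, div_lt_one this]
  exact hz.1

theorem norm_testF_rpow {p : ℝ} (hp : 0 < p) {ξ z : ℂ × ℂ} (hξ : ξ ∈ Hartogs)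
    (hz : z ∈ Hartogs) :
    ‖testF p ξ z‖ ^ p = ‖z.2‖ ^ (-p) * (1 / ‖1 - z.2 * conj ξ.2‖ ^ 2) *
      (1 / ‖1 - z.1 / z.2 * conj (ξ.1 / ξ.2)‖ ^ 2) := by
  rw [testF, ← map_div₀, ← map_div₀, mul_comm z.2, ← div_div, div_eq_mul_inv _ z.2, norm_mul,
    norm_mul, Real.mul_rpow (by positivity) (by positivity),
    Real.mul_rpow (by positivity) (by positivity),
    norm_cpow_div_rpow hp (norm_one_sub_mul_conj_comm _ _)
      (one_sub_mul_conj_ne_zero hz.2.le hξ.2),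
    norm_cpow_div_rpow hp (norm_one_sub_mul_conj_comm _ _)
      (one_sub_mul_conj_ne_zero (norm_div_lt_one_of_mem_Hartogs hz).le
        (norm_div_lt_one_of_mem_Hartogs hξ)), norm_inv,
    Real.inv_rpow (norm_nonneg _), Real.rpow_neg (norm_nonneg _)]
  ring

/-- The weighted integral `∫_𝔻 |z|^q / |1 - z ā|² dV(z)` over the unit disc. -/
noncomputable def discIntegral (q : ℝ) (a : ℂ) : ℝ :=
  ∫ z in Metric.ball (0 : ℂ) 1, ‖z‖ ^ q / ‖1 - z * conj a‖ ^ 2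

theorem discIntegral_eq_punctured (q : ℝ) (a : ℂ) :
    ∫ z in Metric.ball (0 : ℂ) 1 \ {0}, ‖z‖ ^ q / ‖1 - z * conj a‖ ^ 2 = discIntegral q a :=
  setIntegral_congr_set (sdiff_null_ae_eq_self (measure_singleton 0))

theorem integral_testF {p : ℝ} (hp : 0 < p) {ξ : ℂ × ℂ} (hξ : ξ ∈ Hartogs) :
    ∫ z, ‖testF p ξ z‖ ^ p ∂muH =
      discIntegral (2 - p) ξ.2 * discIntegral 0 (ξ.1 / ξ.2) / π ^ 2 := by
  have hpball : MeasurableSet (Metric.ball (0 : ℂ) 1 \ {0}) :=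
    Metric.isOpen_ball.measurableSet.diff (measurableSet_singleton 0)
  rw [integral_muH, setIntegral_congr_fun measurableSet_Hartogs
    (fun z hz => norm_testF_rpow hp hξ hz), ← discIntegral_eq_punctured, discIntegral,
    integral_eq_lintegral_of_nonneg_ae (.of_forall fun _ => by positivity)
      (by apply Measurable.aestronglyMeasurable; fun_prop),
    integral_eq_lintegral_of_nonneg_ae (.of_forall fun _ => by positivity)
      (by apply Measurable.aestronglyMeasurable; fun_prop),
    integral_eq_lintegral_of_nonneg_ae (.of_forall fun _ => by positivity)
      (by apply Measurable.aestronglyMeasurable; fun_prop), ← ENNReal.toReal_mul]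
  congr 2
  have h1 := lintegral_Hartogs_mul
    (fun w => ENNReal.ofReal (‖w‖ ^ (-p) * (1 / ‖1 - w * conj ξ.2‖ ^ 2)))
    (fun u => ENNReal.ofReal (1 / ‖1 - u * conj (ξ.1 / ξ.2)‖ ^ 2)) (by fun_prop) (by fun_prop)
  have hnn : ∀ w : ℂ, 0 ≤ ‖w‖ ^ (-p) * (1 / ‖1 - w * conj ξ.2‖ ^ 2) := fun w => by positivity
  simp_rw [← ENNReal.ofReal_mul (hnn _)] at h1
  rw [h1]
  congr 1
  · refine setLIntegral_congr_fun hpball fun w hw => ?_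
    have : 0 < ‖w‖ := norm_pos_iff.2 hw.2
    rw [← ENNReal.ofReal_mul (by positivity), sub_eq_add_neg 2 p, Real.rpow_add this, Real.rpow_two]
    ring_nf
  · simp

theorem norm_polarCoord_symm {r : ℝ} (hr : 0 < r) (θ : ℝ) :
    ‖Complex.polarCoord.symm (r, θ)‖ = r := by
  simp [abs_of_pos hr]

theorem integral_one_div_norm_one_sub_polar_sq {a : ℂ} (ha : ‖a‖ < 1) {r : ℝ} (hr : r ∈ Ioo (0 : ℝ) 1) :
    ∫ θ in Ioo (-π) π, 1 / ‖1 - Complex.polarCoord.symm (r, θ) * conj a‖ ^ 2 =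
      2 * π / (1 - r ^ 2 * ‖a‖ ^ 2) := by
  have hlt : r * ‖a‖ < 1 := by nlinarith [hr.1, hr.2, norm_nonneg a]
  have hnn : 0 ≤ r * ‖a‖ := mul_nonneg hr.1.le (norm_nonneg a)
  have hpos : 0 < 1 - r ^ 2 * ‖a‖ ^ 2 := by nlinarith
  have hw : (r : ℂ) * a ∈ Metric.ball (0 : ℂ) 1 := by
    simpa [abs_of_pos hr.1] using hlt
  have h := (diffContOnCl_const (𝕜 := ℂ) (s := Metric.ball (0 : ℂ) 1)
    (c := (1 : ℂ))).circleAverage_poissonKernel_smul' hw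
  have hker : ∀ θ : ℝ, (‖circleMap 0 1 θ - 0‖ ^ 2 - ‖(r : ℂ) * a - 0‖ ^ 2) /
      ‖circleMap 0 1 θ - 0 - ((r : ℂ) * a - 0)‖ ^ 2 =
      (1 - r ^ 2 * ‖a‖ ^ 2) * (1 / ‖1 - Complex.polarCoord.symm (r, θ) * conj a‖ ^ 2) := by
    intro θ
    have hpol : Complex.polarCoord.symm (r, θ) = r * circleMap 0 1 θ := by
      simp [Complex.polarCoord_symm_apply, circleMap, Complex.exp_mul_I]
    have hfac : circleMap 0 1 θ - (r : ℂ) * a =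
        circleMap 0 1 θ * conj (1 - r * circleMap 0 1 θ * conj a) := by
      have hc : circleMap 0 1 θ * conj (circleMap 0 1 θ) = 1 := by
        rw [Complex.mul_conj, Complex.normSq_eq_norm_sq]
        simp
      simp only [map_sub, map_one, map_mul, Complex.conj_conj, Complex.conj_ofReal]
      linear_combination (r * a) * hc
    rw [hpol, sub_zero, sub_zero, hfac, norm_mul (circleMap 0 1 θ), RCLike.norm_conj]
    simp [abs_of_pos hr.1, mul_pow, div_eq_mul_inv]
  rw [circleAverage_eq_integral_add (-π)] at h
  have hshift := intervalIntegral.integral_comp_add_right (a := 0) (b := 2 * π)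
    (fun θ => ((‖circleMap 0 1 θ - 0‖ ^ 2 - ‖(r : ℂ) * a - 0‖ ^ 2) /
      ‖circleMap 0 1 θ - 0 - ((r : ℂ) * a - 0)‖ ^ 2) • (1 : ℂ)) (-π)
  rw [hshift, show 0 + -π = -π by ring, show 2 * π + -π = π by ring,
    intervalIntegral.integral_smul_const] at h
  simp_rw [hker] at h
  rw [intervalIntegral.integral_const_mul,
    intervalIntegral.integral_of_le (by linarith [pi_pos]), integral_Ioc_eq_integral_Ioo,
    Complex.real_smul, Complex.real_smul, mul_one, ← Complex.ofReal_mul,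
    Complex.ofReal_eq_one] at h
  have := pi_pos
  rw [eq_div_iff hpos.ne']
  field_simp at h
  linarith

/-- The radial integral `∫₀¹ r^s / (1 - r²t²) dr`. -/
noncomputable def radialIntegral (s t : ℝ) : ℝ :=
  ∫ r in Ioo (0 : ℝ) 1, r ^ s / (1 - r ^ 2 * t ^ 2)

theorem discIntegral_eq_radialIntegral (q : ℝ) {a : ℂ} (ha : ‖a‖ < 1) :
    discIntegral q a = 2 * π * radialIntegral (q + 1) ‖a‖ := by
  have hball : MeasurableSet (Metric.ball (0 : ℂ) 1) := Metric.isOpen_ball.measurableSet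
  have hden : ∀ r ∈ Ioo (0 : ℝ) 1, 0 < 1 - r ^ 2 * ‖a‖ ^ 2 := fun r hr => by
    have h1 : r ^ 2 < 1 := by nlinarith [hr.1, hr.2]
    have h2 : ‖a‖ ^ 2 < 1 := by nlinarith [norm_nonneg a]
    nlinarith [sq_nonneg ‖a‖]
  rw [discIntegral, radialIntegral, ← integral_const_mul,
    integral_eq_lintegral_of_nonneg_ae (.of_forall fun _ => by positivity)
      (by apply Measurable.aestronglyMeasurable; fun_prop),
    integral_eq_lintegral_of_nonneg_ae
      ((ae_restrict_iff' measurableSet_Ioo).2 (.of_forall fun r hr => by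
        have := hden r hr
        have := hr.1
        simp only [Pi.zero_apply]
        positivity))
      (by apply Measurable.aestronglyMeasurable; fun_prop)]
  congr 1
  set F : ℂ → ENNReal := (Metric.ball (0 : ℂ) 1).indicator
    (fun z => ENNReal.ofReal (‖z‖ ^ q / ‖1 - z * conj a‖ ^ 2)) with hF
  have hFm : Measurable F := Measurable.indicator (by fun_prop) hball
  have hsymm : Measurable fun x : ℝ × ℝ => Complex.polarCoord.symm x := by
    simp_rw [Complex.polarCoord_symm_apply]
    fun_prop
  rw [← lintegral_indicator hball, ← hF, ← Complex.lintegral_comp_polarCoord_symm,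
    polarCoord_target, Measure.volume_eq_prod,
    setLIntegral_prod _ (by
      apply Measurable.aemeasurable
      simp only [smul_eq_mul]
      exact (by fun_prop : Measurable fun x : ℝ × ℝ => ENNReal.ofReal x.1).mul (hFm.comp hsymm))]
  have hIoo : Ioo (0 : ℝ) 1 = Iio 1 ∩ Ioi 0 := by
    rw [inter_comm, Ioi_inter_Iio]
  rw [hIoo, ← Measure.restrict_restrict measurableSet_Iio, ← lintegral_indicator measurableSet_Iio]
  refine setLIntegral_congr_fun measurableSet_Ioi fun r (hr : 0 < r) => ?_
  by_cases hr1 : r < 1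
  · have hmem : ∀ θ, Complex.polarCoord.symm (r, θ) ∈ Metric.ball (0 : ℂ) 1 := fun θ => by
      rw [mem_ball_zero_iff, norm_polarCoord_symm hr]; exact hr1
    rw [indicator_of_mem (show r ∈ Iio 1 from hr1)]
    have hcont : Continuous fun θ : ℝ =>
        1 / ‖1 - Complex.polarCoord.symm (r, θ) * conj a‖ ^ 2 := by
      refine continuous_const.div ?_ fun θ => ?_
      · simp_rw [Complex.polarCoord_symm_apply]
        fun_prop
      · have := one_sub_mul_conj_ne_zero
          (mem_ball_zero_iff.1 (hmem θ)).le ha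
        positivity
    have hint : IntegrableOn (fun θ : ℝ =>
        1 / ‖1 - Complex.polarCoord.symm (r, θ) * conj a‖ ^ 2) (Ioo (-π) π) :=
      hcont.integrableOn_Icc.mono_set Ioo_subset_Icc_self
    have key : ∀ θ, ENNReal.ofReal r • F (Complex.polarCoord.symm (r, θ)) =
        ENNReal.ofReal (r ^ (q + 1)) *
          ENNReal.ofReal (1 / ‖1 - Complex.polarCoord.symm (r, θ) * conj a‖ ^ 2) := fun θ => by
      rw [hF, indicator_of_mem (hmem θ), norm_polarCoord_symm hr, smul_eq_mul,
        ← ENNReal.ofReal_mul hr.le, ← ENNReal.ofReal_mul (by positivity),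
        Real.rpow_add_one hr.ne']
      ring_nf
    simp_rw [key]
    rw [lintegral_const_mul _ hcont.measurable.ennreal_ofReal,
      ← ofReal_integral_eq_lintegral_ofReal hint (.of_forall fun _ => by positivity),
      integral_one_div_norm_one_sub_polar_sq ha ⟨hr, hr1⟩, ← ENNReal.ofReal_mul (by positivity)]
    ring_nf
  · rw [indicator_of_notMem (show r ∉ Iio 1 from hr1)]
    refine (lintegral_congr fun θ => ?_).trans lintegral_zero
    rw [hF, indicator_of_notMem, smul_zero]
    rwa [mem_ball_zero_iff, norm_polarCoord_symm hr]

theorem one_sub_sq_mul_sq_pos {r t : ℝ} (hr0 : 0 ≤ r) (hr1 : r ≤ 1) (ht0 : 0 ≤ t) (ht1 : t < 1) :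
    0 < 1 - r ^ 2 * t ^ 2 := by
  rw [← mul_pow, sub_pos]
  exact pow_lt_one₀ (by positivity) (by nlinarith) two_ne_zero

theorem integrableOn_rpow_Ioo {s : ℝ} (hs : -1 < s) :
    IntegrableOn (fun r : ℝ => r ^ s) (Ioo 0 1) :=
  ((intervalIntegral.intervalIntegrable_rpow' hs (a := 0) (b := 1)).1).mono_set Ioo_subset_Ioc_self

theorem integrableOn_radial {s t : ℝ} (hs : -1 < s) (ht0 : 0 ≤ t) (ht1 : t < 1) :
    IntegrableOn (fun r : ℝ => r ^ s / (1 - r ^ 2 * t ^ 2)) (Ioo 0 1) := by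
  have h1 : IntegrableOn (fun r : ℝ => r ^ s) (Icc 0 1) :=
    integrableOn_Icc_iff_integrableOn_Ioo (by simp) (by simp) |>.2 (integrableOn_rpow_Ioo hs)
  refine IntegrableOn.mono_set ?_ Ioo_subset_Icc_self
  simp_rw [div_eq_mul_inv]
  refine h1.mul_continuousOn ?_ isCompact_Icc
  exact ContinuousOn.inv₀ (by fun_prop) fun r hr =>
    (one_sub_sq_mul_sq_pos hr.1 hr.2 ht0 ht1).ne'

theorem radialIntegral_one {t : ℝ} (ht0 : 0 < t) (ht1 : t < 1) :
    radialIntegral 1 t = Real.log (1 / (1 - t ^ 2)) / (2 * t ^ 2) := by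
  have hint := integrableOn_radial (s := 1) (by norm_num) ht0.le ht1
  rw [radialIntegral, ← integral_Ioc_eq_integral_Ioo, ← intervalIntegral.integral_of_le zero_le_one]
  rw [intervalIntegral.integral_eq_sub_of_hasDerivAt
    (f := fun r => -Real.log (1 - r ^ 2 * t ^ 2) / (2 * t ^ 2))]
  · rw [one_div, Real.log_inv]
    simp
  · intro r hr
    rw [uIcc_of_le zero_le_one] at hr
    have hpos := one_sub_sq_mul_sq_pos hr.1 hr.2 ht0.le ht1
    have hd : HasDerivAt (fun r : ℝ => 1 - r ^ 2 * t ^ 2) (-(2 * r * t ^ 2)) r := by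
      simpa using (((hasDerivAt_id r).pow 2).mul_const (t ^ 2)).const_sub 1
    convert! (hd.log hpos.ne').neg.div_const (2 * t ^ 2) using 1
    rw [Real.rpow_one]
    field_simp
  · rw [intervalIntegrable_iff_integrableOn_Ioc_of_le zero_le_one,
      integrableOn_Ioc_iff_integrableOn_Ioo]
    exact hint

theorem radialIntegral_le {s t : ℝ} (hs : -1 < s) (ht0 : 0 ≤ t) (ht1 : t < 1) :
    radialIntegral s t ≤ radialIntegral 1 t + 1 / (s + 1) := by
  have hpow : ∫ r in Ioo (0 : ℝ) 1, r ^ s = 1 / (s + 1) := by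
    rw [← integral_Ioc_eq_integral_Ioo, ← intervalIntegral.integral_of_le zero_le_one,
      integral_rpow (.inl hs), Real.one_rpow, Real.zero_rpow (by linarith), sub_zero]
  have h1 := integrableOn_radial (s := 1) (by norm_num) ht0 ht1
  have h2 := integrableOn_rpow_Ioo hs
  rw [← hpow, radialIntegral, radialIntegral, ← integral_add h1 h2]
  refine setIntegral_mono_on (integrableOn_radial hs ht0 ht1) (h1.add h2) measurableSet_Ioo
    fun r hr => ?_
  have hpos := one_sub_sq_mul_sq_pos hr.1.le hr.2.le ht0 ht1
  have hsq : r ^ 2 * t ^ 2 ≤ r ^ 2 := mul_le_of_le_one_right (by positivity) (by nlinarith)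
  have hrs : r ^ s * r ^ 2 ≤ r := by
    rw [← Real.rpow_natCast, ← Real.rpow_add hr.1]
    simpa using Real.rpow_le_rpow_of_exponent_ge hr.1 hr.2.le
      (show (1 : ℝ) ≤ s + (2 : ℕ) by push_cast; linarith)
  have hr0 : 0 ≤ r ^ s := Real.rpow_nonneg hr.1.le _
  rw [div_add' _ _ _ hpos.ne', Real.rpow_one]
  gcongr
  nlinarith

theorem le_radialIntegral {s t : ℝ} (hs : -1 < s) (hs' : s ≤ 3) (ht0 : 0 ≤ t) (ht1 : t < 1) :
    radialIntegral 1 t - 1 / 2 ≤ radialIntegral s t := by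
  have hid : ∫ r in Ioo (0 : ℝ) 1, r ^ (1 : ℝ) = 1 / 2 := by
    rw [← integral_Ioc_eq_integral_Ioo, ← intervalIntegral.integral_of_le zero_le_one,
      integral_rpow (.inl (by norm_num))]
    norm_num
  have h1 := integrableOn_radial (s := 1) (by norm_num) ht0 ht1
  have h2 := integrableOn_rpow_Ioo (s := 1) (by norm_num)
  rw [← hid, radialIntegral, radialIntegral, ← integral_sub h1 h2]
  refine setIntegral_mono_on (h1.sub h2) (integrableOn_radial hs ht0 ht1) measurableSet_Ioo
    fun r hr => ?_
  have hpos := one_sub_sq_mul_sq_pos hr.1.le hr.2.le ht0 ht1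
  have hsq : r ^ 2 * t ^ 2 ≤ r ^ 2 := mul_le_of_le_one_right (by positivity) (by nlinarith)
  have hrs : r ^ 3 ≤ r ^ s := by
    rw [← Real.rpow_natCast]
    exact Real.rpow_le_rpow_of_exponent_ge hr.1 hr.2.le (by push_cast; linarith)
  rw [div_sub' hpos.ne', Real.rpow_one]
  gcongr
  nlinarith [hr.1]

theorem two_le_log_of_near_one {t : ℝ} (ht : 19 / 20 < t) (ht1 : t < 1) :
    2 ≤ Real.log (1 / (1 - t ^ 2)) := by
  have hpos : 0 < 1 - t ^ 2 := by nlinarith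
  rw [Real.le_log_iff_exp_le (by positivity), le_div_iff₀ hpos]
  have he : Real.exp 2 < 8 := by
    have : Real.exp 2 = Real.exp 1 ^ 2 := by rw [← Real.exp_nat_mul]; norm_num
    rw [this]
    nlinarith [Real.exp_one_lt_d9, Real.exp_pos 1]
  nlinarith [Real.exp_pos 2]

theorem radialIntegral_one_bounds {t : ℝ} (ht : 19 / 20 < t) (ht1 : t < 1) :
    Real.log (1 / (1 - t ^ 2)) / 2 ≤ radialIntegral 1 t ∧
      radialIntegral 1 t ≤ Real.log (1 / (1 - t ^ 2)) := by
  have hL := two_le_log_of_near_one ht ht1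
  rw [radialIntegral_one (by linarith) ht1]
  have ht2 : 0 < t ^ 2 := by nlinarith
  constructor
  · gcongr
    nlinarith
  · exact div_le_self (by linarith) (by nlinarith)

/-- The `p`-th power of the `L^p(ℋ,μ)`-norm of the test function `f_{(ξ₁,ξ₂)}`
reduces to an iterated disc integral, and is comparable to
`log(1/(1-|ξ₂|²)) · log(1/(1-|ξ₁/ξ₂|²))` as `|ξ₂|, |ξ₁/ξ₂| → 1⁻`. -/
theorem testF_norm_estimate (p : ℝ) (hp1 : 4 / 3 < p) (hp2 : p < 4) :
    (∀ ξ ∈ Hartogs,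
      ∫ z, ‖testF p ξ z‖ ^ p ∂muH =
        (∫ z₂ in Metric.ball (0:ℂ) 1 \ {0},
            ‖z₂‖ ^ (2 - p) / ‖1 - z₂ * conj ξ.2‖ ^ 2 *
              ((∫ u in Metric.ball (0:ℂ) 1,
                  1 / ‖1 - conj ξ.1 / conj ξ.2 * u‖ ^ 2) / π)) / π) ∧
    ∃ c C δ : ℝ, 0 < c ∧ 0 < C ∧ 0 < δ ∧ δ < 1 ∧
      ∀ ξ ∈ Hartogs, δ < ‖ξ.2‖ → δ < ‖ξ.1 / ξ.2‖ →
        c * Real.log (1 / (1 - ‖ξ.2‖ ^ 2)) * Real.log (1 / (1 - ‖ξ.1 / ξ.2‖ ^ 2)) ≤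
            ∫ z, ‖testF p ξ z‖ ^ p ∂muH ∧
          ∫ z, ‖testF p ξ z‖ ^ p ∂muH ≤
            C * Real.log (1 / (1 - ‖ξ.2‖ ^ 2)) * Real.log (1 / (1 - ‖ξ.1 / ξ.2‖ ^ 2)) := by
  have hp : 0 < p := by linarith
  refine ⟨fun ξ hξ => ?_, 1 / 2, 4 * (1 + 1 / (4 - p)), 19 / 20, by norm_num, ?_, by norm_num,
    by norm_num, fun ξ hξ h2 h1 => ?_⟩
  · have hinner : ∫ u in Metric.ball (0:ℂ) 1, 1 / ‖1 - conj ξ.1 / conj ξ.2 * u‖ ^ 2 =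
        discIntegral 0 (ξ.1 / ξ.2) := by
      simp only [discIntegral, Real.rpow_zero, map_div₀]
      simp_rw [mul_comm]
    rw [integral_testF hp hξ, hinner, integral_mul_const, discIntegral_eq_punctured]
    field_simp
  · have : 0 < 4 - p := by linarith
    positivity
  have hb : ‖ξ.1 / ξ.2‖ < 1 := norm_div_lt_one_of_mem_Hartogs hξ
  have h2' : ‖ξ.2‖ < 1 := hξ.2
  have hN : ∫ z, ‖testF p ξ z‖ ^ p ∂muH =
      4 * radialIntegral (3 - p) ‖ξ.2‖ * radialIntegral 1 ‖ξ.1 / ξ.2‖ := by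
    rw [integral_testF hp hξ, discIntegral_eq_radialIntegral _ hξ.2,
      discIntegral_eq_radialIntegral _ hb, zero_add, show 2 - p + 1 = 3 - p by ring]
    field_simp
    ring
  rw [hN]
  have hL1 := two_le_log_of_near_one h1 hb
  have hL2 := two_le_log_of_near_one h2 h2'
  obtain ⟨hl1, hu1⟩ := radialIntegral_one_bounds h1 hb
  obtain ⟨hl2, hu2⟩ := radialIntegral_one_bounds h2 h2'
  have hlow := le_radialIntegral (s := 3 - p) (by linarith) (by linarith) (norm_nonneg ξ.2) h2'
  have hupp := radialIntegral_le (s := 3 - p) (by linarith) (norm_nonneg ξ.2) h2'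
  rw [show 3 - p + 1 = 4 - p by ring] at hupp
  have hc : 0 < 1 / (4 - p) := one_div_pos.2 (by linarith)
  generalize 1 / (4 - p) = K at *
  generalize Real.log (1 / (1 - ‖ξ.1 / ξ.2‖ ^ 2)) = L₁ at *
  generalize Real.log (1 / (1 - ‖ξ.2‖ ^ 2)) = L₂ at *
  constructor
  · calc 1 / 2 * L₂ * L₁ = 4 * (L₂ / 4) * (L₁ / 2) := by ring
      _ ≤ _ := by gcongr <;> linarith
  · have hle : radialIntegral (3 - p) ‖ξ.2‖ ≤ (1 + K) * L₂ := by nlinarith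
    rw [mul_assoc 4 (1 + K) L₂]
    gcongr
    linarith
end
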